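/- There exists a universal constant C_K > 0 such that for every α ∈ ℝ, every N ≥ 2, every measurable set Ω ⊆ ℝ² with finite positive area |Ω|, and every normalized N-anyon wave function u whose support is contained in Ω^N: ∑_{j=1}^N ∫_{(ℝ²)^N} |D_j u|² dx ≥ C_K · C_{α,N}² · N²/|Ω|. -/

import Mathlib

open MeasureTheory

noncomputable section

/-- Squared magnitude of the covariant derivative `D_j u` at configuration `x`;
the plane `ℝ²` is identified with `ℂ` (so `a^⊥ = I·a`, and the two components of a
vector field are the real and imaginary parts). -/
def covSq (α : ℝ) {N : ℕ} (u : (Fin N → ℂ) → ℂ) (j : Fin N) (x : Fin N → ℂ) : ℝ :=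
  let A : ℂ := (α : ℂ) * ∑ k ∈ Finset.univ.erase j,
    Complex.I * (x j - x k) / ((‖x j - x k‖ : ℂ) ^ 2)
  ‖-Complex.I * fderiv ℝ u x (Pi.single j 1) + (A.re : ℂ) * u x‖ ^ 2 +
    ‖-Complex.I * fderiv ℝ u x (Pi.single j Complex.I) + (A.im : ℂ) * u x‖ ^ 2

/-- The statistics constant `C_{α,N} = min_{p ∈ {0,…,N-2}} min_{q ∈ ℤ} |(2p+1)α - 2q|`. -/
def statC (α : ℝ) (N : ℕ) : ℝ :=
  ⨅ p : Fin (N - 1), ⨅ q : ℤ, |(2 * ((p : ℕ) : ℝ) + 1) * α - 2 * (q : ℝ)|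

/-- `N`-anyon wave function in the magnetic gauge (smooth compactly supported
form-core representative): totally symmetric with support away from the diagonals. -/
structure IsAnyonWF (N : ℕ) (u : (Fin N → ℂ) → ℂ) : Prop where
  smooth : ContDiff ℝ (⊤ : ℕ∞) u
  compactSupport : HasCompactSupport u
  symmetric : ∀ (σ : Equiv.Perm (Fin N)) (x : Fin N → ℂ), u (x ∘ σ) = u x
  offDiagonal : ∀ x ∈ tsupport u, ∀ j k : Fin N, j ≠ k → x j ≠ x k

/-- One-particle density of an `N`-particle wave function. -/
def density (N : ℕ) (u : (Fin N → ℂ) → ℂ) (y : ℂ) : ℝ :=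
  ∑ j : Fin N, ∫ z : {k : Fin N // k ≠ j} → ℂ,
    ‖u (fun k => if h : k = j then y else z ⟨k, h⟩)‖ ^ 2

theorem statC_nonneg (α : ℝ) (N : ℕ) : 0 ≤ statC α N :=
  Real.iInf_nonneg fun _ => Real.iInf_nonneg fun _ => abs_nonneg _

theorem statC_le (α : ℝ) (N p : ℕ) (hp : p < N - 1) (q : ℤ) :
    statC α N ≤ |(2 * (p : ℝ) + 1) * α - 2 * (q : ℝ)| := by
  unfold statC
  refine (ciInf_le ⟨0, ?_⟩ (⟨p, hp⟩ : Fin (N - 1))).trans (ciInf_le ⟨0, ?_⟩ q)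
  · rintro _ ⟨p, rfl⟩
    exact Real.iInf_nonneg fun _ => abs_nonneg _
  · rintro _ ⟨q, rfl⟩
    exact abs_nonneg _

theorem abs_sub_two_mul_round_le (y : ℝ) : |y - 2 * (round (y / 2) : ℝ)| ≤ 1 := by
  have h := abs_sub_round (y / 2)
  rw [abs_le] at *
  constructor <;> linarith [h.1, h.2]

theorem statC_le_one (α : ℝ) (N : ℕ) (hN : 2 ≤ N) : statC α N ≤ 1 := by
  refine (statC_le α N 0 (by omega) (round (α / 2))).trans ?_
  simpa using abs_sub_two_mul_round_le α

/-- The holonomy of `2p+1` half-windings is bounded below by the statistics constant. -/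
theorem two_mul_statC_le_norm (α : ℝ) (N p : ℕ) (hp : p < N - 1) :
    2 * statC α N ≤
      ‖Complex.exp (Complex.I * ((Real.pi * ((2 * (p : ℝ) + 1) * α) : ℝ) : ℂ)) - 1‖ := by
  set β : ℝ := (2 * (p : ℝ) + 1) * α
  set q : ℤ := round (β / 2)
  have hle : statC α N ≤ |β - 2 * (q : ℝ)| := statC_le α N p hp q
  have h1 : |β - 2 * (q : ℝ)| ≤ 1 := abs_sub_two_mul_round_le β
  have hexp : Complex.exp (Complex.I * ((Real.pi * β : ℝ) : ℂ))
      = Complex.exp (Complex.I * ((Real.pi * (β - 2 * q) : ℝ) : ℂ)) := by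
    rw [Complex.exp_eq_exp_iff_exists_int]
    refine ⟨q, ?_⟩
    push_cast
    ring
  rw [hexp, Complex.norm_exp_I_mul_ofReal_sub_one, norm_mul, Real.norm_eq_abs, Real.norm_eq_abs,
    abs_two]
  refine mul_le_mul_of_nonneg_left (hle.trans ?_) zero_le_two
  generalize β - 2 * (q : ℝ) = y at h1
  have hpi := Real.pi_pos
  have key : |y| ≤ Real.sin (Real.pi * |y| / 2) := by
    have := Real.mul_le_sin (x := Real.pi * |y| / 2) (by positivity) (by nlinarith)
    refine le_trans (le_of_eq ?_) this
    field_simp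
  rcases le_total 0 y with hy | hy
  · rw [abs_of_nonneg hy] at *
    exact key.trans (le_abs_self _)
  · rw [abs_of_nonpos hy] at *
    have h2 : Real.sin (Real.pi * y / 2) = - Real.sin (Real.pi * -y / 2) := by
      rw [← Real.sin_neg]; congr 1; ring
    rw [h2, abs_neg]
    exact key.trans (le_abs_self _)

theorem sq_intervalIntegral_le {f : ℝ → ℝ} (hf : Continuous f) {b : ℝ} (hb : 0 < b) :
    (∫ t in (0 : ℝ)..b, f t) ^ 2 ≤ b * ∫ t in (0 : ℝ)..b, f t ^ 2 := by
  set m := (∫ t in (0 : ℝ)..b, f t) / b with hm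
  have hI : (∫ t in (0 : ℝ)..b, f t) = m * b := by rw [hm]; field_simp
  have h0 : 0 ≤ ∫ t in (0 : ℝ)..b, (f t - m) ^ 2 :=
    intervalIntegral.integral_nonneg hb.le fun t _ => sq_nonneg _
  have h1 : ∫ t in (0 : ℝ)..b, (f t - m) ^ 2
      = (∫ t in (0 : ℝ)..b, f t ^ 2) - 2 * m * (∫ t in (0 : ℝ)..b, f t) + b * m ^ 2 := by
    have : ∀ t, (f t - m) ^ 2 = f t ^ 2 - 2 * m * f t + m ^ 2 := fun t => by ring
    simp only [this]
    rw [intervalIntegral.integral_add, intervalIntegral.integral_sub,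
      intervalIntegral.integral_const_mul, intervalIntegral.integral_const]
    · simp
    all_goals exact Continuous.intervalIntegrable (by fun_prop) _ _
  rw [h1, hI] at h0
  rw [hI]
  nlinarith

/-- A periodic function on an interval has covariant energy bounded below by the holonomy. -/
theorem holonomy_le_energy {g g' : ℝ → ℂ} {a : ℝ → ℝ} {b : ℝ} (hb : 0 < b)
    (hg : ∀ t, HasDerivAt g (g' t) t) (hg' : Continuous g') (ha : Continuous a)
    (hper : g b = g 0) :
    ‖Complex.exp (Complex.I * ((∫ t in (0 : ℝ)..b, a t : ℝ) : ℂ)) - 1‖ ^ 2 * ‖g 0‖ ^ 2 ≤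
      b * ∫ t in (0 : ℝ)..b, ‖-Complex.I * g' t + a t * g t‖ ^ 2 := by
  have hgc : Continuous g := continuous_iff_continuousAt.2 fun t => (hg t).continuousAt
  set Φ : ℝ → ℝ := fun t => ∫ s in (0 : ℝ)..t, a s with hΦ
  have hΦd : ∀ t, HasDerivAt Φ (a t) t := fun t =>
    intervalIntegral.integral_hasDerivAt_right (ha.intervalIntegrable _ _)
      ha.aestronglyMeasurable.stronglyMeasurableAtFilter ha.continuousAt
  have hΦc : Continuous Φ := continuous_iff_continuousAt.2 fun t => (hΦd t).continuousAt
  set h : ℝ → ℂ := fun t => Complex.exp (Complex.I * (Φ t : ℂ)) * g t with hh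
  set h' : ℝ → ℂ := fun t => Complex.exp (Complex.I * (Φ t : ℂ)) * Complex.I *
    (-Complex.I * g' t + a t * g t) with hh'
  have hd : ∀ t, HasDerivAt h (h' t) t := by
    intro t
    have h1 : HasDerivAt (fun t => Complex.exp (Complex.I * (Φ t : ℂ)))
        (Complex.exp (Complex.I * (Φ t : ℂ)) * (Complex.I * (a t : ℂ))) t :=
      (((hΦd t).ofReal_comp).const_mul Complex.I).cexp
    refine (h1.mul (hg t)).congr_deriv ?_
    simp only [hh']
    linear_combination (Complex.exp (Complex.I * (Φ t : ℂ)) * g' t) * Complex.I_sq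
  have hc : Continuous h' := by
    simp only [hh']
    fun_prop
  have hftc : ∫ t in (0 : ℝ)..b, h' t = h b - h 0 :=
    intervalIntegral.integral_eq_sub_of_hasDerivAt (fun t _ => hd t) (hc.intervalIntegrable _ _)
  have hdiff : h b - h 0 = (Complex.exp (Complex.I * (Φ b : ℂ)) - 1) * g 0 := by
    simp [hh, hper, hΦ, sub_mul]
  have hn : ∀ t, ‖h' t‖ = ‖-Complex.I * g' t + a t * g t‖ := by
    intro t
    simp only [hh', norm_mul, Complex.norm_I, mul_one]
    rw [mul_comm Complex.I, Complex.norm_exp_ofReal_mul_I, one_mul]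
  have hle : ‖h b - h 0‖ ≤ ∫ t in (0 : ℝ)..b, ‖h' t‖ := by
    rw [← hftc]
    exact intervalIntegral.norm_integral_le_integral_norm hb.le
  calc _ = ‖h b - h 0‖ ^ 2 := by rw [hdiff, norm_mul, mul_pow]
    _ ≤ (∫ t in (0 : ℝ)..b, ‖h' t‖) ^ 2 := by gcongr
    _ ≤ b * ∫ t in (0 : ℝ)..b, ‖h' t‖ ^ 2 := sq_intervalIntegral_le hc.norm hb
    _ = _ := by simp only [hn]

theorem exp_add_ne_zero {d : ℂ} (hd : ‖d‖ ≠ 1) (t : ℝ) :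
    Complex.exp (t * Complex.I) + d ≠ 0 := by
  intro h
  apply hd
  rw [eq_neg_of_add_eq_zero_right h, norm_neg, Complex.norm_exp_ofReal_mul_I]

theorem exp_sub_ne_zero {d : ℂ} (hd : ‖d‖ ≠ 1) (t : ℝ) :
    Complex.exp (t * Complex.I) - d ≠ 0 := by
  have := exp_add_ne_zero (d := -d) (by rwa [norm_neg]) t
  rwa [← sub_eq_add_neg] at this

/-- The winding of the unit circle around the point `-d`. -/
theorem integral_winding {d : ℂ} (hd : ‖d‖ ≠ 1) :
    ∫ t in (0 : ℝ)..2 * Real.pi, Complex.I * Complex.exp (t * Complex.I) /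
      (Complex.exp (t * Complex.I) + d) = if ‖d‖ < 1 then 2 * Real.pi * Complex.I else 0 := by
  have hci : ∫ t in (0 : ℝ)..2 * Real.pi, Complex.I * Complex.exp (t * Complex.I) /
      (Complex.exp (t * Complex.I) + d) = ∮ z in C(0, 1), (z - -d)⁻¹ := by
    simp only [circleIntegral, deriv_circleMap, circleMap, smul_eq_mul]
    congr 1
    ext t
    simp [div_eq_mul_inv, mul_comm]
  rw [hci]
  split_ifs with h
  · exact circleIntegral.integral_sub_inv_of_mem_ball (by simpa using h)
  · have hne : ∀ z ∈ Metric.closedBall (0 : ℂ) 1, z - -d ≠ 0 := by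
      intro z hz h0
      have : ‖z‖ ≤ 1 := by simpa using hz
      rw [sub_eq_zero.1 h0, norm_neg] at this
      exact h (lt_of_le_of_ne this hd)
    refine Complex.circleIntegral_eq_zero_of_differentiable_on_off_countable zero_le_one
      Set.countable_empty (ContinuousOn.inv₀ (by fun_prop) hne) ?_
    intro z hz
    exact DifferentiableAt.inv (by fun_prop) (hne z (Metric.ball_subset_closedBall hz.1))

/-- The combined winding of two antipodal points moving along half a circle. -/
theorem integral_half_winding {d : ℂ} (hd : ‖d‖ ≠ 1) :
    ∫ t in (0 : ℝ)..Real.pi, (Complex.I * Complex.exp (t * Complex.I) /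
      (Complex.exp (t * Complex.I) + d) + Complex.I * Complex.exp (t * Complex.I) /
      (Complex.exp (t * Complex.I) - d)) = if ‖d‖ < 1 then 2 * Real.pi * Complex.I else 0 := by
  have hc : Continuous fun t : ℝ => Complex.I * Complex.exp (t * Complex.I) /
      (Complex.exp (t * Complex.I) + d) :=
    Continuous.div (by fun_prop) (by fun_prop) (exp_add_ne_zero hd)
  have hc' : Continuous fun t : ℝ => Complex.I * Complex.exp (t * Complex.I) /
      (Complex.exp (t * Complex.I) - d) :=
    Continuous.div (by fun_prop) (by fun_prop) (exp_sub_ne_zero hd)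
  rw [← integral_winding hd, intervalIntegral.integral_add (hc.intervalIntegrable _ _)
    (hc'.intervalIntegrable _ _), ← intervalIntegral.integral_add_adjacent_intervals
    (hc.intervalIntegrable 0 Real.pi) (hc.intervalIntegrable Real.pi (2 * Real.pi))]
  congr 1
  have := intervalIntegral.integral_comp_add_right (a := 0) (b := Real.pi)
    (fun t : ℝ => Complex.I * Complex.exp (t * Complex.I) / (Complex.exp (t * Complex.I) + d))
    Real.pi
  rw [zero_add, ← two_mul] at this
  rw [← this]
  refine intervalIntegral.integral_congr fun t _ => ?_
  have he : Complex.exp (((t + Real.pi : ℝ) : ℂ) * Complex.I) = -Complex.exp (t * Complex.I) := by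
    push_cast
    rw [add_mul, Complex.exp_add, Complex.exp_pi_mul_I, mul_neg_one]
  simp only [he]
  rw [div_eq_div_iff (exp_sub_ne_zero hd t)]
  · ring
  · have := exp_sub_ne_zero hd t
    intro h
    apply this
    linear_combination -h

/-- The magnetic potential `A_j`, written as a complex number. -/
def gaugeA (α : ℝ) {N : ℕ} (x : Fin N → ℂ) (j : Fin N) : ℂ :=
  (α : ℂ) * ∑ k ∈ Finset.univ.erase j, Complex.I * (x j - x k) / ((‖x j - x k‖ : ℂ) ^ 2)

/-- The covariant derivative of `u` with respect to particle `j` in the direction `v`. -/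
def covDir (α : ℝ) {N : ℕ} (u : (Fin N → ℂ) → ℂ) (j : Fin N) (x : Fin N → ℂ) (v : ℂ) : ℂ :=
  -Complex.I * fderiv ℝ u x (Pi.single j v) +
    ((v.re * (gaugeA α x j).re + v.im * (gaugeA α x j).im : ℝ) : ℂ) * u x

theorem covSq_nonneg (α : ℝ) {N : ℕ} (u : (Fin N → ℂ) → ℂ) (j : Fin N) (x : Fin N → ℂ) :
    0 ≤ covSq α u j x := by
  unfold covSq
  positivity

theorem norm_covDir_sq_le (α : ℝ) {N : ℕ} (u : (Fin N → ℂ) → ℂ) (j : Fin N) (x : Fin N → ℂ)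
    (v : ℂ) : ‖covDir α u j x v‖ ^ 2 ≤ ‖v‖ ^ 2 * covSq α u j x := by
  set D₁ := -Complex.I * fderiv ℝ u x (Pi.single j 1) + ((gaugeA α x j).re : ℂ) * u x with hD₁
  set D₂ := -Complex.I * fderiv ℝ u x (Pi.single j Complex.I) +
    ((gaugeA α x j).im : ℂ) * u x with hD₂
  have hcov : covSq α u j x = ‖D₁‖ ^ 2 + ‖D₂‖ ^ 2 := rfl
  have hsingle : (Pi.single j v : Fin N → ℂ) =
      v.re • (Pi.single j 1 : Fin N → ℂ) + v.im • (Pi.single j Complex.I : Fin N → ℂ) := by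
    rw [← Pi.single_smul, ← Pi.single_smul, ← Pi.single_add]
    congr 1
    simp
  have hdir : covDir α u j x v = v.re * D₁ + v.im * D₂ := by
    rw [covDir, hsingle, map_add, map_smul, map_smul, hD₁, hD₂, Complex.real_smul,
      Complex.real_smul]
    push_cast
    ring
  have hv : ‖v‖ ^ 2 = |v.re| ^ 2 + |v.im| ^ 2 := by
    rw [Complex.sq_norm, Complex.normSq_apply, sq_abs, sq_abs]
    ring
  rw [hcov, hdir, hv]
  have h1 : ‖(v.re : ℂ) * D₁ + v.im * D₂‖ ≤ |v.re| * ‖D₁‖ + |v.im| * ‖D₂‖ := by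
    refine (norm_add_le _ _).trans (le_of_eq ?_)
    rw [norm_mul, norm_mul, Complex.norm_real, Complex.norm_real, Real.norm_eq_abs,
      Real.norm_eq_abs]
  refine (pow_le_pow_left₀ (norm_nonneg _) h1 2).trans ?_
  nlinarith [sq_nonneg (|v.re| * ‖D₂‖ - |v.im| * ‖D₁‖)]

theorem re_mul_add_im_mul_perp (v w : ℂ) :
    v.re * (Complex.I * w / ((‖w‖ : ℂ) ^ 2)).re + v.im * (Complex.I * w / ((‖w‖ : ℂ) ^ 2)).im
      = (v / w).im := by
  have h : ((‖w‖ : ℂ) ^ 2) = ((Complex.normSq w : ℝ) : ℂ) := by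
    rw [Complex.normSq_eq_norm_sq]
    push_cast
    rfl
  rw [h, Complex.div_ofReal_re, Complex.div_ofReal_im, Complex.div_im]
  simp only [Complex.mul_re, Complex.mul_im, Complex.I_re, Complex.I_im]
  ring

theorem re_mul_gaugeA (α : ℝ) {N : ℕ} (x : Fin N → ℂ) (j : Fin N) (v : ℂ) :
    v.re * (gaugeA α x j).re + v.im * (gaugeA α x j).im =
      α * ∑ k ∈ Finset.univ.erase j, (v / (x j - x k)).im := by
  rw [Finset.sum_congr rfl fun k _ => (re_mul_add_im_mul_perp v (x j - x k)).symm]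
  simp only [gaugeA, Complex.re_ofReal_mul, Complex.im_ofReal_mul, Complex.re_sum, Complex.im_sum,
    Finset.sum_add_distrib, ← Finset.mul_sum]
  ring

/-- Rotation of the pair `(x_j, x_k)` by the angle `t` about its midpoint. -/
def pairRotate {N : ℕ} (j k : Fin N) (t : ℝ) (x : Fin N → ℂ) : Fin N → ℂ :=
  x + ((Complex.exp (t * Complex.I) - 1) * ((x j - x k) / 2)) •
    (Pi.single j 1 - Pi.single k 1 : Fin N → ℂ)

section pairRotate

variable {N : ℕ} {j k : Fin N}

theorem pairRotate_left (h : j ≠ k) (t : ℝ) (x : Fin N → ℂ) :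
    pairRotate j k t x j = (x j + x k) / 2 + Complex.exp (t * Complex.I) * ((x j - x k) / 2) := by
  simp [pairRotate, h]
  ring

theorem pairRotate_right (h : j ≠ k) (t : ℝ) (x : Fin N → ℂ) :
    pairRotate j k t x k = (x j + x k) / 2 - Complex.exp (t * Complex.I) * ((x j - x k) / 2) := by
  simp [pairRotate, h.symm]
  ring

theorem pairRotate_of_ne {l : Fin N} (hj : l ≠ j) (hk : l ≠ k) (t : ℝ) (x : Fin N → ℂ) :
    pairRotate j k t x l = x l := by
  simp [pairRotate, hj, hk]

theorem pairRotate_zero (x : Fin N → ℂ) : pairRotate j k 0 x = x := by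
  simp [pairRotate]

theorem pairRotate_pi (h : j ≠ k) (x : Fin N → ℂ) :
    pairRotate j k Real.pi x = x ∘ Equiv.swap j k := by
  ext l
  by_cases hj : l = j
  · subst hj
    rw [pairRotate_left h, Function.comp, Equiv.swap_apply_left, Complex.exp_pi_mul_I]
    ring
  by_cases hk : l = k
  · subst hk
    rw [pairRotate_right h, Function.comp, Equiv.swap_apply_right, Complex.exp_pi_mul_I]
    ring
  rw [pairRotate_of_ne hj hk, Function.comp, Equiv.swap_apply_of_ne_of_ne hj hk]

theorem continuous_pairRotate :
    Continuous fun p : (Fin N → ℂ) × ℝ => pairRotate j k p.2 p.1 := by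
  unfold pairRotate
  fun_prop

theorem hasDerivAt_pairRotate (x : Fin N → ℂ) (t : ℝ) :
    HasDerivAt (fun t : ℝ => pairRotate j k t x)
      (Pi.single j (Complex.I * Complex.exp (t * Complex.I) * ((x j - x k) / 2)) -
        Pi.single k (Complex.I * Complex.exp (t * Complex.I) * ((x j - x k) / 2))) t := by
  have h1 : HasDerivAt (fun t : ℝ => (Complex.exp (t * Complex.I) - 1) * ((x j - x k) / 2))
      (Complex.I * Complex.exp (t * Complex.I) * ((x j - x k) / 2)) t := by
    have h0 : HasDerivAt (fun t : ℝ => (t : ℂ) * Complex.I) (1 * Complex.I) t :=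
      (Complex.ofRealCLM.hasDerivAt (x := t)).mul_const Complex.I
    refine ((h0.cexp.sub_const 1).mul_const _).congr_deriv ?_
    ring
  refine ((h1.smul_const (Pi.single j 1 - Pi.single k 1 : Fin N → ℂ)).const_add x).congr_deriv ?_
  rw [smul_sub, ← Pi.single_smul, ← Pi.single_smul, smul_eq_mul, mul_one]

/-- The tangential component of the potential along the orbit of a rotating pair. -/
theorem gauge_along_pairRotate (α : ℝ) (h : j ≠ k) (x : Fin N → ℂ) (hjk : x j ≠ x k)
    (hx : ∀ l, l ≠ j → l ≠ k → ‖((x j + x k) / 2 - x l) / ((x j - x k) / 2)‖ ≠ 1) (t : ℝ) :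
    (α * ∑ l ∈ Finset.univ.erase j, (Complex.I * Complex.exp (t * Complex.I) *
        ((x j - x k) / 2) / (pairRotate j k t x j - pairRotate j k t x l)).im) -
      (α * ∑ l ∈ Finset.univ.erase k, (Complex.I * Complex.exp (t * Complex.I) *
        ((x j - x k) / 2) / (pairRotate j k t x k - pairRotate j k t x l)).im) =
    α * (1 + ∑ l ∈ (Finset.univ.erase j).erase k,
      (Complex.I * Complex.exp (t * Complex.I) / (Complex.exp (t * Complex.I) +
        ((x j + x k) / 2 - x l) / ((x j - x k) / 2)) +
      Complex.I * Complex.exp (t * Complex.I) / (Complex.exp (t * Complex.I) -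
        ((x j + x k) / 2 - x l) / ((x j - x k) / 2))).im) := by
  have hr : (x j - x k) / 2 ≠ 0 := div_ne_zero (sub_ne_zero.2 hjk) two_ne_zero
  have hkj : k ∈ Finset.univ.erase j := by simp [h.symm]
  have hjk' : j ∈ Finset.univ.erase k := by simp [h]
  rw [← Finset.add_sum_erase _ _ hkj, ← Finset.add_sum_erase _ _ hjk',
    Finset.erase_right_comm (a := k), ← mul_sub, add_sub_add_comm, ← Finset.sum_sub_distrib]
  have he := Complex.exp_ne_zero ((t : ℂ) * Complex.I)
  congr 2
  · rw [pairRotate_left h, pairRotate_right h, ← Complex.sub_im]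
    generalize (x j - x k) / 2 = r at *
    generalize Complex.exp (t * Complex.I) = e at *
    have : Complex.I * e * r / ((x j + x k) / 2 + e * r - ((x j + x k) / 2 - e * r)) -
        Complex.I * e * r / ((x j + x k) / 2 - e * r - ((x j + x k) / 2 + e * r))
        = Complex.I := by
      have h1 : (x j + x k) / 2 + e * r - ((x j + x k) / 2 - e * r) = 2 * (e * r) := by ring
      have h2 : (x j + x k) / 2 - e * r - ((x j + x k) / 2 + e * r) = -(2 * (e * r)) := by ring
      rw [h1, h2]
      field_simp
      ring
    rw [this, Complex.I_im]
  · refine Finset.sum_congr rfl fun l hl => ?_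
    have hl' : l ≠ k ∧ l ≠ j := by simpa using hl
    have hd := hx l hl'.2 hl'.1
    have h1 := exp_add_ne_zero hd t
    have h2 := exp_sub_ne_zero hd t
    rw [pairRotate_left h, pairRotate_right h, pairRotate_of_ne hl'.2 hl'.1, ← Complex.sub_im]
    generalize (x j + x k) / 2 = R at *
    generalize (x j - x k) / 2 = r at *
    generalize Complex.exp (t * Complex.I) = e at *
    congr 1
    have h3 : R + e * r - x l = r * (e + (R - x l) / r) := by field_simp; ring
    have h4 : R - e * r - x l = -(r * (e - (R - x l) / r)) := by field_simp; ring
    rw [h3, h4, div_neg, sub_neg_eq_add]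
    congr 1
    · rw [mul_comm r, mul_div_mul_right _ _ hr]
    · rw [mul_comm r, mul_div_mul_right _ _ hr]

end pairRotate

section pairEnergy

variable {N : ℕ} {j k : Fin N}

/-- The holonomy picked up by a wave function when a pair of particles is exchanged. -/
theorem exists_integral_gauge (α : ℝ) (h : j ≠ k) (x : Fin N → ℂ)
    (hx : ∀ l, l ≠ j → l ≠ k → ‖((x j + x k) / 2 - x l) / ((x j - x k) / 2)‖ ≠ 1) :
    ∃ p < N - 1, ∫ t in (0 : ℝ)..Real.pi, α * (1 + ∑ l ∈ (Finset.univ.erase j).erase k,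
      (Complex.I * Complex.exp (t * Complex.I) / (Complex.exp (t * Complex.I) +
        ((x j + x k) / 2 - x l) / ((x j - x k) / 2)) +
      Complex.I * Complex.exp (t * Complex.I) / (Complex.exp (t * Complex.I) -
        ((x j + x k) / 2 - x l) / ((x j - x k) / 2))).im) =
      Real.pi * ((2 * (p : ℝ) + 1) * α) := by
  set d : Fin N → ℂ := fun l => ((x j + x k) / 2 - x l) / ((x j - x k) / 2)
  set S := (Finset.univ.erase j).erase k with hS
  have hx' : ∀ l ∈ S, ‖d l‖ ≠ 1 := fun l hl => by
    have hl' : l ≠ k ∧ l ≠ j := by simpa [hS] using hl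
    exact hx l hl'.2 hl'.1
  set w : Fin N → ℝ → ℂ := fun l t => Complex.I * Complex.exp (t * Complex.I) /
    (Complex.exp (t * Complex.I) + d l) + Complex.I * Complex.exp (t * Complex.I) /
    (Complex.exp (t * Complex.I) - d l) with hw
  have hwc : ∀ l ∈ S, Continuous (w l) := fun l hl =>
    (Continuous.div (by fun_prop) (by fun_prop) (exp_add_ne_zero (hx' l hl))).add
      (Continuous.div (by fun_prop) (by fun_prop) (exp_sub_ne_zero (hx' l hl)))
  have hwi : ∀ l ∈ S, IntervalIntegrable (fun t => (w l t).im) volume 0 Real.pi := fun l hl =>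
    (Complex.continuous_im.comp (hwc l hl)).intervalIntegrable _ _
  have hsum : IntervalIntegrable (fun t => ∑ l ∈ S, (w l t).im) volume 0 Real.pi :=
    (continuous_finsetSum _ fun l hl => Complex.continuous_im.comp (hwc l hl)).intervalIntegrable
      _ _
  have hint : ∀ l ∈ S, ∫ t in (0 : ℝ)..Real.pi, (w l t).im =
      if ‖d l‖ < 1 then 2 * Real.pi else 0 := by
    intro l hl
    have h1 := Complex.imCLM.intervalIntegral_comp_comm
      ((hwc l hl).intervalIntegrable (μ := volume) 0 Real.pi)
    simp only [Complex.imCLM_apply] at h1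
    rw [h1, integral_half_winding (hx' l hl)]
    split_ifs <;> simp
  refine ⟨(S.filter fun l => ‖d l‖ < 1).card, ?_, ?_⟩
  · have h1 : (S.filter fun l => ‖d l‖ < 1).card ≤ S.card := Finset.card_filter_le _ _
    have h2 : S.card = N - 1 - 1 := by
      rw [hS, Finset.card_erase_of_mem (by simp [h.symm]), Finset.card_erase_of_mem (by simp)]
      simp
    have h3 : 1 < Fintype.card (Fin N) := Fintype.one_lt_card_iff.2 ⟨j, k, h⟩
    rw [Fintype.card_fin] at h3
    omega
  · change ∫ t in (0 : ℝ)..Real.pi, α * (1 + ∑ l ∈ S, (w l t).im) = _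
    rw [intervalIntegral.integral_const_mul, intervalIntegral.integral_add
      intervalIntegrable_const hsum, intervalIntegral.integral_const,
      intervalIntegral.integral_finsetSum hwi, Finset.sum_congr rfl hint,
      ← Finset.sum_filter, Finset.sum_const]
    simp only [sub_zero, smul_eq_mul, mul_one, nsmul_eq_mul]
    ring

/-- Exchange of the pair `(j, k)` along half a circle: the amplitude is controlled by the
kinetic energy along that half circle. -/
theorem statC_sq_le_lintegral_pairRotate (α : ℝ) {u : (Fin N → ℂ) → ℂ} (hu : IsAnyonWF N u)
    (h : j ≠ k) (x : Fin N → ℂ) (hjk : x j ≠ x k)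
    (hx : ∀ l, l ≠ j → l ≠ k → ‖((x j + x k) / 2 - x l) / ((x j - x k) / 2)‖ ≠ 1) :
    ENNReal.ofReal (4 * statC α N ^ 2 * ‖u x‖ ^ 2) ≤
      ENNReal.ofReal (2 * Real.pi * ‖(x j - x k) / 2‖ ^ 2) *
        ∫⁻ t in Set.Ioc 0 Real.pi, ENNReal.ofReal
          (covSq α u j (pairRotate j k t x) + covSq α u k (pairRotate j k t x)) := by
  obtain ⟨p, hp, hgauge⟩ := exists_integral_gauge α h x hx
  set a : ℝ → ℝ := fun t => α * (1 + ∑ l ∈ (Finset.univ.erase j).erase k,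
      (Complex.I * Complex.exp (t * Complex.I) / (Complex.exp (t * Complex.I) +
        ((x j + x k) / 2 - x l) / ((x j - x k) / 2)) +
      Complex.I * Complex.exp (t * Complex.I) / (Complex.exp (t * Complex.I) -
        ((x j + x k) / 2 - x l) / ((x j - x k) / 2))).im) with ha
  have hac : Continuous a := by
    refine continuous_const.mul (continuous_const.add (continuous_finsetSum _ fun l hl => ?_))
    have hl' : l ≠ k ∧ l ≠ j := by simpa using hl
    exact Complex.continuous_im.comp
      ((Continuous.div (by fun_prop) (by fun_prop) (exp_add_ne_zero (hx l hl'.2 hl'.1))).add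
      (Continuous.div (by fun_prop) (by fun_prop) (exp_sub_ne_zero (hx l hl'.2 hl'.1))))
  set ζ : ℝ → ℂ := fun t => Complex.I * Complex.exp (t * Complex.I) * ((x j - x k) / 2) with hζ
  have hζn : ∀ t, ‖ζ t‖ = ‖(x j - x k) / 2‖ := fun t => by
    simp only [hζ]
    rw [norm_mul, norm_mul, Complex.norm_I, Complex.norm_exp_ofReal_mul_I, one_mul, one_mul]
  have hζc : Continuous ζ := by fun_prop
  set g : ℝ → ℂ := fun t => u (pairRotate j k t x) with hg
  set g' : ℝ → ℂ := fun t => fderiv ℝ u (pairRotate j k t x)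
    (Pi.single j (ζ t) - Pi.single k (ζ t)) with hg'
  have hTc : Continuous fun t : ℝ => pairRotate j k t x :=
    continuous_pairRotate.comp (Continuous.prodMk_right x)
  have hgd : ∀ t, HasDerivAt g (g' t) t := fun t =>
    ((hu.smooth.differentiable (by simp)).differentiableAt.hasFDerivAt).comp_hasDerivAt t
      (hasDerivAt_pairRotate x t)
  have hsc : ∀ i : Fin N, Continuous fun t => (Pi.single i (ζ t) : Fin N → ℂ) := fun i =>
    (continuous_single i).comp hζc
  have hg'c : Continuous g' :=
    ((hu.smooth.continuous_fderiv (by simp)).comp hTc).clm_apply ((hsc j).sub (hsc k))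
  have hper : g Real.pi = g 0 := by
    simp only [hg]
    rw [pairRotate_pi h, pairRotate_zero, hu.symmetric]
  have hen := holonomy_le_energy Real.pi_pos hgd hg'c hac hper
  rw [hgauge] at hen
  have hcov : ∀ t, -Complex.I * g' t + a t * g t =
      covDir α u j (pairRotate j k t x) (ζ t) - covDir α u k (pairRotate j k t x) (ζ t) := by
    intro t
    have h1 : a t = _ := (gauge_along_pairRotate α h x hjk hx t).symm
    rw [h1, covDir, covDir, re_mul_gaugeA, re_mul_gaugeA]
    simp only [hg', hg, map_sub]
    push_cast
    ring
  have hbound : ∀ t, ‖-Complex.I * g' t + a t * g t‖ ^ 2 ≤ 2 * ‖(x j - x k) / 2‖ ^ 2 *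
      (covSq α u j (pairRotate j k t x) + covSq α u k (pairRotate j k t x)) := by
    intro t
    rw [hcov]
    have h1 := norm_covDir_sq_le α u j (pairRotate j k t x) (ζ t)
    have h2 := norm_covDir_sq_le α u k (pairRotate j k t x) (ζ t)
    rw [hζn] at h1 h2
    have h3 := norm_sub_le (covDir α u j (pairRotate j k t x) (ζ t))
      (covDir α u k (pairRotate j k t x) (ζ t))
    have h4 := pow_le_pow_left₀ (norm_nonneg _) h3 2
    nlinarith [sq_nonneg (‖covDir α u j (pairRotate j k t x) (ζ t)‖ -
      ‖covDir α u k (pairRotate j k t x) (ζ t)‖)]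
  have hC : 4 * statC α N ^ 2 * ‖u x‖ ^ 2 ≤
      Real.pi * ∫ t in (0 : ℝ)..Real.pi, ‖-Complex.I * g' t + a t * g t‖ ^ 2 := by
    refine le_trans ?_ hen
    have h0 : g 0 = u x := by simp only [hg, pairRotate_zero]
    rw [h0]
    have h1 := two_mul_statC_le_norm α N p hp
    have h2 := pow_le_pow_left₀ (by linarith [statC_nonneg α N]) h1 2
    have h3 := mul_le_mul_of_nonneg_right h2 (sq_nonneg ‖u x‖)
    linarith
  have hgc : Continuous g := continuous_iff_continuousAt.2 fun t => (hgd t).continuousAt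
  have hcont : Continuous fun t => ‖-Complex.I * g' t + a t * g t‖ ^ 2 := by fun_prop
  refine (ENNReal.ofReal_le_ofReal hC).trans ?_
  rw [intervalIntegral.integral_of_le Real.pi_pos.le, ENNReal.ofReal_mul Real.pi_pos.le,
    ofReal_integral_eq_lintegral_ofReal
      (hcont.integrableOn_Ioc) (Filter.Eventually.of_forall fun t => by positivity)]
  have hconst : ENNReal.ofReal (2 * Real.pi * ‖(x j - x k) / 2‖ ^ 2) =
      ENNReal.ofReal Real.pi * ENNReal.ofReal (2 * ‖(x j - x k) / 2‖ ^ 2) := by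
    rw [← ENNReal.ofReal_mul Real.pi_pos.le]
    congr 1
    ring
  rw [hconst, mul_assoc]
  gcongr
  rw [← lintegral_const_mul' _ _ ENNReal.ofReal_ne_top]
  refine lintegral_mono fun t => ?_
  rw [← ENNReal.ofReal_mul (by positivity)]
  exact ENNReal.ofReal_le_ofReal (hbound t)

end pairEnergy

theorem measurePreserving_pairRotate {N : ℕ} {j k : Fin N} (h : j ≠ k) (t : ℝ) :
    MeasurePreserving (pairRotate j k t) volume volume := by
  set f : (Fin N → ℂ) →ₗ[ℂ] (Fin N → ℂ) := LinearMap.transvection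
    (((Complex.exp (t * Complex.I) - 1) / 2) •
      (LinearMap.proj (R := ℂ) (φ := fun _ : Fin N => ℂ) j - LinearMap.proj k))
    (Pi.single j 1 - Pi.single k 1) with hf
  have hdet : LinearMap.det f = Complex.exp (t * Complex.I) := by
    rw [hf, LinearMap.transvection.det]
    simp [h, h.symm]
    ring
  have hdetR : LinearMap.det (f.restrictScalars ℝ) = 1 := by
    rw [LinearMap.det_restrictScalars, hdet, Algebra.norm_complex_apply,
      Complex.normSq_eq_norm_sq, Complex.norm_exp_ofReal_mul_I, one_pow]
  have hfun : pairRotate j k t = ⇑(f.restrictScalars ℝ) := by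
    ext1 x
    simp only [pairRotate, hf, LinearMap.coe_restrictScalars, LinearMap.transvection.apply,
      LinearMap.smul_apply, LinearMap.sub_apply, LinearMap.proj_apply, smul_eq_mul]
    congr 2
    ring
  refine ⟨(continuous_pairRotate.comp (Continuous.prodMk_left t)).measurable, ?_⟩
  rw [hfun, Measure.map_linearMap_addHaar_eq_smul_addHaar _ (by rw [hdetR]; exact one_ne_zero),
    hdetR]
  simp

/-- For almost every configuration, no third particle lies on the circle with diameter
`[x_j, x_k]`. -/
theorem ae_norm_ne_one {N : ℕ} (j k : Fin N) :
    ∀ᵐ x : Fin N → ℂ, ∀ l, l ≠ j → l ≠ k →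
      ‖((x j + x k) / 2 - x l) / ((x j - x k) / 2)‖ ≠ 1 := by
  rw [ae_all_iff]
  intro l
  by_cases hlj : l = j
  · exact Filter.Eventually.of_forall fun x h => absurd hlj h
  by_cases hlk : l = k
  · exact Filter.Eventually.of_forall fun x _ h => absurd hlk h
  set s : Set (Fin N → ℂ) :=
    {x | ((x j - x l) * (starRingEnd ℂ) (x k - x l)).re ≠ 0} with hs
  have hso : IsOpen s := by
    refine isOpen_ne_fun ?_ continuous_const
    exact Complex.continuous_re.comp (by fun_prop)
  have hae : ∀ᵐ x : Fin N → ℂ, x ∈ s := by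
    set L : ℝ →ₗ[ℝ] (Fin N → ℂ) :=
      LinearMap.toSpanSingleton ℝ _ (fun i => if i = l then 0 else 1) with hL
    refine ae_mem_of_ae_add_linearMap_mem L volume volume hso.measurableSet fun y => ?_
    have hset : ∀ t : ℝ, y + L t ∈ s ↔ t ^ 2 + ((y j - y l).re + (y k - y l).re) * t +
        ((y j - y l) * (starRingEnd ℂ) (y k - y l)).re ≠ 0 := by
      intro t
      simp only [hs, Set.mem_ofPred_eq, hL, LinearMap.toSpanSingleton_apply, Pi.add_apply,
        Pi.smul_apply, Ne.symm hlj, Ne.symm hlk, if_true, if_false]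
      refine not_congr (Eq.congr_left ?_)
      simp [Complex.mul_re]
      ring
    simp only [hset]
    generalize (y j - y l).re + (y k - y l).re = b
    generalize ((y j - y l) * (starRingEnd ℂ) (y k - y l)).re = c
    rw [ae_iff]
    refine Set.Finite.measure_zero ?_ _
    simp only [not_not]
    by_cases hne : ∃ t₀ : ℝ, t₀ ^ 2 + b * t₀ + c = 0
    · obtain ⟨t₀, ht₀⟩ := hne
      refine (Set.toFinite {t₀, -b - t₀}).subset fun t ht => ?_
      have ht' : t ^ 2 + b * t + c = 0 := ht
      have : (t - t₀) * (t + b + t₀) = 0 := by linear_combination ht' - ht₀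
      rcases mul_eq_zero.1 this with h | h
      · left; linarith
      · right
        rw [Set.mem_singleton_iff]
        linarith
    · convert Set.finite_empty
      exact Set.eq_empty_of_forall_notMem fun t ht => hne ⟨t, ht⟩
  filter_upwards [hae] with x hx _ _ h1
  apply hx
  by_cases hr : (x j - x k) / 2 = 0
  · rw [hr, div_zero, norm_zero] at h1
    exact absurd h1 zero_ne_one
  rw [norm_div, div_eq_one_iff_eq (norm_ne_zero_iff.2 hr)] at h1
  have h2 := congrArg (· ^ 2) h1
  simp only [Complex.sq_norm, Complex.normSq_apply] at h2
  simp [Complex.mul_re] at h2 ⊢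
  linarith

theorem measurable_covSq (α : ℝ) {N : ℕ} {u : (Fin N → ℂ) → ℂ} (hu : ContDiff ℝ (⊤ : ℕ∞) u)
    (j : Fin N) : Measurable (covSq α u j) := by
  have hA : Measurable fun x : Fin N → ℂ => gaugeA α x j := by
    unfold gaugeA
    refine Measurable.const_mul (Finset.measurable_sum _ fun k _ => ?_) _
    fun_prop
  have hd : ∀ v : ℂ, Measurable fun x => fderiv ℝ u x (Pi.single j v) := fun v =>
    ((hu.continuous_fderiv (by simp)).clm_apply continuous_const).measurable
  have h1 := hd 1
  have h2 := hd Complex.I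
  have hum : Measurable u := hu.continuous.measurable
  change Measurable fun x =>
    ‖-Complex.I * fderiv ℝ u x (Pi.single j 1) + ((gaugeA α x j).re : ℂ) * u x‖ ^ 2 +
    ‖-Complex.I * fderiv ℝ u x (Pi.single j Complex.I) + ((gaugeA α x j).im : ℂ) * u x‖ ^ 2
  fun_prop

/-- Weight of a pair of particles at distance at most `2ℓ`: the inverse of the number of
particles in the neighbourhood of the pair. -/
def pairWeight {N : ℕ} (ℓ : ℝ) (j k : Fin N) (x : Fin N → ℂ) : ℝ :=
  if ‖x j - x k‖ ≤ 2 * ℓ then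
    (1 + ∑ i ∈ (Finset.univ.erase j).erase k,
      if ‖x i - (x j + x k) / 2‖ ≤ 3 * ℓ then (1 : ℝ) else 0)⁻¹
  else 0

section pairWeight

variable {N : ℕ} {ℓ : ℝ} {j k : Fin N}

theorem pairWeight_nonneg (x : Fin N → ℂ) : 0 ≤ pairWeight ℓ j k x := by
  unfold pairWeight
  positivity

theorem pairWeight_comm (x : Fin N → ℂ) : pairWeight ℓ j k x = pairWeight ℓ k j x := by
  unfold pairWeight
  rw [norm_sub_rev, Finset.erase_right_comm, add_comm (x j)]

theorem pairWeight_pairRotate (h : j ≠ k) (t : ℝ) (x : Fin N → ℂ) :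
    pairWeight ℓ j k (pairRotate j k t x) = pairWeight ℓ j k x := by
  have h1 : pairRotate j k t x j - pairRotate j k t x k =
      Complex.exp (t * Complex.I) * (x j - x k) := by
    rw [pairRotate_left h, pairRotate_right h]
    ring
  have h2 : pairRotate j k t x j + pairRotate j k t x k = x j + x k := by
    rw [pairRotate_left h, pairRotate_right h]
    ring
  unfold pairWeight
  rw [h1, h2, norm_mul, Complex.norm_exp_ofReal_mul_I, one_mul]
  congr 3
  refine Finset.sum_congr rfl fun i hi => ?_
  have hi' : i ≠ k ∧ i ≠ j := by simpa using hi
  rw [pairRotate_of_ne hi'.2 hi'.1]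

theorem measurable_pairWeight : Measurable (pairWeight ℓ j k) := by
  unfold pairWeight
  refine Measurable.ite (measurableSet_le (by fun_prop) measurable_const) ?_ measurable_const
  refine (Measurable.const_add (Finset.measurable_sum _ fun i _ => ?_) _).inv
  exact Measurable.ite (measurableSet_le (by fun_prop) measurable_const) measurable_const
    measurable_const

theorem sum_pairWeight_le_one (x : Fin N → ℂ) :
    ∑ k ∈ Finset.univ.erase j, pairWeight ℓ j k x ≤ 1 := by
  set S := (Finset.univ.erase j).filter fun k => ‖x j - x k‖ ≤ 2 * ℓ with hS
  have hle : ∀ k ∈ S, pairWeight ℓ j k x ≤ (S.card : ℝ)⁻¹ := by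
    intro k hk
    have hk' : k ≠ j ∧ ‖x j - x k‖ ≤ 2 * ℓ := by simpa [hS] using hk
    rw [pairWeight, if_pos hk'.2]
    have hpos : 0 < (S.card : ℝ) := by exact_mod_cast Finset.card_pos.2 ⟨k, hk⟩
    refine inv_anti₀ hpos ?_
    rw [← Finset.sum_filter, Finset.sum_const, nsmul_eq_mul, mul_one]
    have hsub : S.erase k ⊆ ((Finset.univ.erase j).erase k).filter
        fun i => ‖x i - (x j + x k) / 2‖ ≤ 3 * ℓ := by
      intro i hi
      have hi' : i ≠ k ∧ i ≠ j ∧ ‖x j - x i‖ ≤ 2 * ℓ := by simpa [hS] using hi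
      simp only [Finset.mem_filter, Finset.mem_erase, Finset.mem_univ, and_true]
      refine ⟨⟨hi'.1, hi'.2.1⟩, ?_⟩
      have h1 : x i - (x j + x k) / 2 = -(x j - x i) + (1 / 2 : ℂ) * (x j - x k) := by ring
      have h2 : ‖(1 / 2 : ℂ)‖ = 1 / 2 := by norm_num
      rw [h1]
      refine (norm_add_le _ _).trans ?_
      rw [norm_neg, norm_mul, h2]
      linarith [hi'.2.2, hk'.2]
    have hcard := Finset.card_le_card hsub
    rw [Finset.card_erase_of_mem hk] at hcard
    have : S.card ≤ 1 + (((Finset.univ.erase j).erase k).filter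
        fun i => ‖x i - (x j + x k) / 2‖ ≤ 3 * ℓ).card := by omega
    exact_mod_cast this
  have hsum : ∑ k ∈ Finset.univ.erase j, pairWeight ℓ j k x = ∑ k ∈ S, pairWeight ℓ j k x := by
    rw [hS, Finset.sum_filter]
    refine Finset.sum_congr rfl fun k _ => ?_
    split_ifs with hk
    · rfl
    · rw [pairWeight, if_neg hk]
  rw [hsum]
  refine (Finset.sum_le_sum hle).trans ?_
  rw [Finset.sum_const, nsmul_eq_mul]
  exact mul_inv_le_one

end pairWeight

/-- Weighted Hardy-type inequality for a single pair of anyons. -/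
theorem pair_exclusion (α : ℝ) {N : ℕ} {u : (Fin N → ℂ) → ℂ} (hu : IsAnyonWF N u) {ℓ : ℝ}
    {j k : Fin N} (h : j ≠ k) :
    ∫⁻ x, ENNReal.ofReal (4 * statC α N ^ 2 * (pairWeight ℓ j k x * ‖u x‖ ^ 2)) ≤
      ENNReal.ofReal (2 * Real.pi ^ 2 * ℓ ^ 2) *
        ∫⁻ x, ENNReal.ofReal (pairWeight ℓ j k x * (covSq α u j x + covSq α u k x)) := by
  set G : (Fin N → ℂ) → ENNReal := fun x =>
    ENNReal.ofReal (pairWeight ℓ j k x * (covSq α u j x + covSq α u k x)) with hG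
  have hGm : Measurable G := (measurable_pairWeight.mul
    ((measurable_covSq α hu.smooth j).add (measurable_covSq α hu.smooth k))).ennreal_ofReal
  have hpt : ∀ᵐ x : Fin N → ℂ,
      ENNReal.ofReal (4 * statC α N ^ 2 * (pairWeight ℓ j k x * ‖u x‖ ^ 2)) ≤
        ENNReal.ofReal (2 * Real.pi * ℓ ^ 2) *
          ∫⁻ t in Set.Ioc 0 Real.pi, G (pairRotate j k t x) := by
    filter_upwards [ae_norm_ne_one j k] with x hx
    by_cases hux : u x = 0
    · simp [hux]
    by_cases hfar : ‖x j - x k‖ ≤ 2 * ℓ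
    swap
    · simp [pairWeight, hfar]
    have hjk : x j ≠ x k := hu.offDiagonal x (subset_tsupport _ hux) j k h
    have h1 := statC_sq_le_lintegral_pairRotate α hu h x hjk hx
    have hw := pairWeight_nonneg (ℓ := ℓ) (j := j) (k := k) x
    have hG' : ∀ t, G (pairRotate j k t x) = ENNReal.ofReal (pairWeight ℓ j k x) *
        ENNReal.ofReal (covSq α u j (pairRotate j k t x) + covSq α u k (pairRotate j k t x)) := by
      intro t
      simp only [hG]
      rw [pairWeight_pairRotate h, ENNReal.ofReal_mul hw]
    simp only [hG']
    rw [lintegral_const_mul' _ _ ENNReal.ofReal_ne_top, mul_left_comm,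
      mul_left_comm (ENNReal.ofReal _), ENNReal.ofReal_mul hw]
    gcongr
    refine h1.trans ?_
    gcongr
    rw [norm_div, Complex.norm_ofNat]
    linarith
  refine (lintegral_mono_ae hpt).trans ?_
  have hjoint : Measurable (Function.uncurry fun (x : Fin N → ℂ) (t : ℝ) =>
      G (pairRotate j k t x)) := hGm.comp continuous_pairRotate.measurable
  rw [lintegral_const_mul' _ _ ENNReal.ofReal_ne_top,
    lintegral_lintegral_swap hjoint.aemeasurable]
  have hinv : ∀ t : ℝ, ∫⁻ x, G (pairRotate j k t x) = ∫⁻ x, G x := fun t =>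
    (measurePreserving_pairRotate h t).lintegral_comp hGm
  simp only [hinv]
  rw [lintegral_const, Measure.restrict_apply_univ, Real.volume_Ioc, sub_zero,
    mul_comm (∫⁻ x, G x), ← mul_assoc, ← ENNReal.ofReal_mul (by positivity)]
  refine le_of_eq ?_
  congr 2
  ring

/-- Exclusion principle: the kinetic energy controls the weighted number of close pairs. -/
theorem exclusion (α : ℝ) {N : ℕ} {u : (Fin N → ℂ) → ℂ} (hu : IsAnyonWF N u) (ℓ : ℝ) :
    ∫⁻ x, ENNReal.ofReal (statC α N ^ 2 *
        ((∑ j, ∑ k ∈ Finset.univ.erase j, pairWeight ℓ j k x) * ‖u x‖ ^ 2)) ≤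
      ENNReal.ofReal (Real.pi ^ 2 * ℓ ^ 2) *
        ∑ j : Fin N, ∫⁻ x, ENNReal.ofReal (covSq α u j x) := by
  have hwm : ∀ j k : Fin N, Measurable (pairWeight ℓ j k) := fun j k => measurable_pairWeight
  have hum : Measurable u := hu.smooth.continuous.measurable
  have hem : ∀ j, Measurable (covSq α u j) := measurable_covSq α hu.smooth
  have hpair : ∑ j, ∑ k ∈ Finset.univ.erase j,
      ∫⁻ x, ENNReal.ofReal (4 * statC α N ^ 2 * (pairWeight ℓ j k x * ‖u x‖ ^ 2)) ≤
      ∑ j, ∑ k ∈ Finset.univ.erase j, ENNReal.ofReal (2 * Real.pi ^ 2 * ℓ ^ 2) *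
        ∫⁻ x, ENNReal.ofReal (pairWeight ℓ j k x * (covSq α u j x + covSq α u k x)) :=
    Finset.sum_le_sum fun j _ => Finset.sum_le_sum fun k hk =>
      pair_exclusion α hu (Finset.ne_of_mem_erase hk).symm
  have hl : ∑ j, ∑ k ∈ Finset.univ.erase j,
      ∫⁻ x, ENNReal.ofReal (4 * statC α N ^ 2 * (pairWeight ℓ j k x * ‖u x‖ ^ 2)) =
      4 * ∫⁻ x, ENNReal.ofReal (statC α N ^ 2 *
        ((∑ j, ∑ k ∈ Finset.univ.erase j, pairWeight ℓ j k x) * ‖u x‖ ^ 2)) := by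
    rw [← lintegral_const_mul _ (by fun_prop)]
    rw [Finset.sum_congr rfl fun j _ => (lintegral_finsetSum _ fun k _ => by fun_prop).symm,
      ← lintegral_finsetSum _ (fun j _ => by fun_prop)]
    refine lintegral_congr fun x => ?_
    have hnn : ∀ j k, 0 ≤ 4 * statC α N ^ 2 * (pairWeight ℓ j k x * ‖u x‖ ^ 2) := fun j k =>
      mul_nonneg (by positivity) (mul_nonneg (pairWeight_nonneg x) (by positivity))
    rw [← ENNReal.ofReal_ofNat 4, ← ENNReal.ofReal_mul (by norm_num)]
    simp_rw [← ENNReal.ofReal_sum_of_nonneg (fun k _ => hnn _ k)]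
    rw [← ENNReal.ofReal_sum_of_nonneg (fun j _ => Finset.sum_nonneg fun k _ => hnn j k)]
    congr 1
    simp only [← Finset.mul_sum, ← Finset.sum_mul]
    ring
  have hr : ∑ j, ∑ k ∈ Finset.univ.erase j,
      ∫⁻ x, ENNReal.ofReal (pairWeight ℓ j k x * (covSq α u j x + covSq α u k x)) ≤
      2 * ∑ j : Fin N, ∫⁻ x, ENNReal.ofReal (covSq α u j x) := by
    rw [← lintegral_finsetSum _ (fun j _ => (hem j).ennreal_ofReal),
      ← lintegral_const_mul _ (by fun_prop)]
    rw [Finset.sum_congr rfl fun j _ => (lintegral_finsetSum _ fun k _ => by fun_prop).symm,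
      ← lintegral_finsetSum _ (fun j _ => by fun_prop)]
    refine lintegral_mono fun x => ?_
    have he : ∀ j, 0 ≤ covSq α u j x := fun j => covSq_nonneg α u j x
    have hnn : ∀ j k, 0 ≤ pairWeight ℓ j k x * (covSq α u j x + covSq α u k x) := fun j k =>
      mul_nonneg (pairWeight_nonneg x) (add_nonneg (he j) (he k))
    simp_rw [← ENNReal.ofReal_sum_of_nonneg (fun k _ => hnn _ k)]
    rw [← ENNReal.ofReal_sum_of_nonneg (fun j _ => Finset.sum_nonneg fun k _ => hnn j k),
      ← ENNReal.ofReal_sum_of_nonneg (fun j _ => he j), ← ENNReal.ofReal_ofNat 2,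
      ← ENNReal.ofReal_mul (by norm_num)]
    refine ENNReal.ofReal_le_ofReal ?_
    have h1 : ∀ j, ∑ k ∈ Finset.univ.erase j, pairWeight ℓ j k x * covSq α u j x ≤
        covSq α u j x := fun j => by
      rw [← Finset.sum_mul]
      exact mul_le_of_le_one_left (he j) (sum_pairWeight_le_one x)
    have h2 : ∑ j, ∑ k ∈ Finset.univ.erase j, pairWeight ℓ j k x * covSq α u k x =
        ∑ j, ∑ k ∈ Finset.univ.erase j, pairWeight ℓ j k x * covSq α u j x := by
      rw [Finset.sum_comm' (t' := Finset.univ) (s' := fun k => Finset.univ.erase k)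
        (by simp [eq_comm])]
      refine Finset.sum_congr rfl fun j _ => Finset.sum_congr rfl fun k _ => ?_
      rw [pairWeight_comm]
    simp only [mul_add, Finset.sum_add_distrib]
    rw [h2, ← two_mul]
    gcongr with j
    exact h1 j
  simp_rw [← Finset.mul_sum] at hpair
  rw [hl] at hpair
  have h4 : (4 : ENNReal) * ∫⁻ x, ENNReal.ofReal (statC α N ^ 2 *
        ((∑ j, ∑ k ∈ Finset.univ.erase j, pairWeight ℓ j k x) * ‖u x‖ ^ 2)) ≤
      4 * (ENNReal.ofReal (Real.pi ^ 2 * ℓ ^ 2) *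
        ∑ j : Fin N, ∫⁻ x, ENNReal.ofReal (covSq α u j x)) := by
    refine hpair.trans ((mul_le_mul_right hr _).trans (le_of_eq ?_))
    rw [mul_assoc 2, ENNReal.ofReal_mul zero_le_two, ENNReal.ofReal_ofNat]
    ring
  exact (ENNReal.mul_le_mul_iff_right (by norm_num) (by norm_num)).1 h4

theorem abs_inner_fderiv_le (α : ℝ) {N : ℕ} (u : (Fin N → ℂ) → ℂ) (j : Fin N) (x : Fin N → ℂ)
    (v : ℂ) : |2 * inner ℝ (u x) (fderiv ℝ u x (Pi.single j v))| ≤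
      2 * (‖u x‖ * ‖covDir α u j x v‖) := by
  set a : ℝ := v.re * (gaugeA α x j).re + v.im * (gaugeA α x j).im with ha
  have h1 : fderiv ℝ u x (Pi.single j v) =
      Complex.I * covDir α u j x v - Complex.I * (a * u x) := by
    rw [covDir]
    linear_combination (fderiv ℝ u x (Pi.single j v)) * Complex.I_sq
  have h2 : inner ℝ (u x) (Complex.I * (a * u x)) = 0 := by
    simp only [Complex.inner, Complex.mul_re, Complex.mul_im, Complex.I_re, Complex.I_im,
      Complex.conj_re, Complex.conj_im, Complex.ofReal_re, Complex.ofReal_im]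
    ring
  rw [h1, inner_sub_right, h2, sub_zero, abs_mul, abs_two]
  gcongr
  refine (abs_real_inner_le_norm _ _).trans ?_
  rw [norm_mul, Complex.norm_I, one_mul]

/-- A translate of `u` leaving the support costs kinetic energy. -/
theorem norm_sq_le_lintegral_translate (α : ℝ) {N : ℕ} {u : (Fin N → ℂ) → ℂ}
    (hu : ContDiff ℝ (⊤ : ℕ∞) u) {ℓ δ : ℝ} (hδ : 0 < δ) (j : Fin N)
    (x : Fin N → ℂ) {v : ℂ} (hv : ‖v‖ ≤ 2 * ℓ) (h0 : u (x + Pi.single j v) = 0) :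
    ENNReal.ofReal (‖u x‖ ^ 2) ≤ ∫⁻ t in Set.Ioc (0 : ℝ) 1, ENNReal.ofReal
      (2 * δ * ‖u (x + t • (Pi.single j v : Fin N → ℂ))‖ ^ 2 +
        2 * ℓ ^ 2 / δ * covSq α u j (x + t • (Pi.single j v : Fin N → ℂ))) := by
  set e : Fin N → ℂ := Pi.single j v with he
  set f : ℝ → ℝ := fun t => ‖u (x + t • e)‖ ^ 2 with hf
  set f' : ℝ → ℝ := fun t => 2 * inner ℝ (u (x + t • e)) (fderiv ℝ u (x + t • e) e) with hf'
  have hline : ∀ t : ℝ, HasDerivAt (fun t : ℝ => x + t • e) e t := fun t => by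
    simpa using ((hasDerivAt_id t).smul_const e).const_add x
  have hd : ∀ t, HasDerivAt f (f' t) t := fun t =>
    (((hu.differentiable (by simp)).differentiableAt.hasFDerivAt).comp_hasDerivAt t
      (hline t)).norm_sq
  have hlc : Continuous fun t : ℝ => x + t • e := by fun_prop
  have hc : Continuous f' := continuous_const.mul ((hu.continuous.comp hlc).inner
    (((hu.continuous_fderiv (by simp)).comp hlc).clm_apply continuous_const))
  have hftc : ∫ t in (0 : ℝ)..1, f' t = f 1 - f 0 :=
    intervalIntegral.integral_eq_sub_of_hasDerivAt (fun t _ => hd t) (hc.intervalIntegrable _ _)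
  have hf1 : f 1 = 0 := by simp [hf, h0]
  have hf0 : f 0 = ‖u x‖ ^ 2 := by simp [hf]
  have hle : ‖u x‖ ^ 2 ≤ ∫ t in Set.Ioc (0 : ℝ) 1, ‖f' t‖ := by
    rw [← intervalIntegral.integral_of_le zero_le_one, ← hf0]
    refine le_trans ?_ (intervalIntegral.norm_integral_le_integral_norm zero_le_one)
    rw [hftc, hf1, zero_sub, norm_neg]
    exact le_abs_self _
  refine (ENNReal.ofReal_le_ofReal hle).trans ?_
  rw [ofReal_integral_eq_lintegral_ofReal hc.norm.integrableOn_Ioc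
    (Filter.Eventually.of_forall fun t => norm_nonneg _)]
  refine lintegral_mono fun t => ENNReal.ofReal_le_ofReal ?_
  refine (abs_inner_fderiv_le α u j (x + t • e) v).trans ?_
  have h1 := norm_covDir_sq_le α u j (x + t • e) v
  have h2 : ‖v‖ ^ 2 * covSq α u j (x + t • e) ≤ (2 * ℓ) ^ 2 * covSq α u j (x + t • e) :=
    mul_le_mul_of_nonneg_right (pow_le_pow_left₀ (norm_nonneg _) hv 2) (covSq_nonneg _ _ _ _)
  have h3 := h1.trans h2
  set a := ‖u (x + t • e)‖
  set b := ‖covDir α u j (x + t • e) v‖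
  set c := covSq α u j (x + t • e)
  have h4 : 2 * ℓ ^ 2 / δ * c = (2 * ℓ) ^ 2 * c / (2 * δ) := by field_simp
  have h5 : b ^ 2 / (2 * δ) ≤ (2 * ℓ) ^ 2 * c / (2 * δ) := by gcongr
  have h6 : 2 * δ * a ^ 2 + b ^ 2 / (2 * δ) - 2 * (a * b) = (2 * δ * a - b) ^ 2 / (2 * δ) := by
    field_simp
    ring
  have h7 : 0 ≤ (2 * δ * a - b) ^ 2 / (2 * δ) := by positivity
  linarith

theorem volume_reProdIm (s t : Set ℝ) : volume (s ×ℂ t) = volume s * volume t := by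
  have h := Complex.volume_preserving_equiv_real_prod.measure_preimage_equiv (s ×ˢ t)
  rw [Measure.volume_eq_prod, Measure.prod_prod] at h
  rw [← h]
  rfl

/-- If every point of `S` has sufficiently many translates outside `Ω`, then the mass of a
particle in `S` is controlled by its kinetic energy. -/
theorem sparse_mass_le (α : ℝ) {N : ℕ} {u : (Fin N → ℂ) → ℂ}
    (hu : ContDiff ℝ (⊤ : ℕ∞) u) {ℓ δ : ℝ} (hℓ : 0 < ℓ) (hδ : 0 < δ) (j : Fin N)
    {Ω S : Set ℂ} (hΩ : MeasurableSet Ω)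
    (hsupp : Function.support u ⊆ Set.univ.pi (fun _ : Fin N => Ω))
    (hS : ∀ z ∈ S, ENNReal.ofReal (ℓ ^ 2 / 2) ≤
      volume ((Set.Icc (-ℓ) ℓ ×ℂ Set.Icc (-ℓ) ℓ) ∩ {v | z + v ∉ Ω})) :
    ∫⁻ x in {x | x j ∈ S}, ENNReal.ofReal (‖u x‖ ^ 2) ≤
      8 * ∫⁻ x, ENNReal.ofReal (2 * δ * ‖u x‖ ^ 2 + 2 * ℓ ^ 2 / δ * covSq α u j x) := by
  set V : Set ℂ := Set.Icc (-ℓ) ℓ ×ℂ Set.Icc (-ℓ) ℓ with hV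
  have hVvol : volume V = ENNReal.ofReal (4 * ℓ ^ 2) := by
    rw [hV, volume_reProdIm, Real.volume_Icc, ← ENNReal.ofReal_mul (by linarith)]
    congr 1
    ring
  have hVm : MeasurableSet V := (measurableSet_Icc.preimage Complex.measurable_re).inter
    (measurableSet_Icc.preimage Complex.measurable_im)
  have hVn : ∀ v ∈ V, ‖v‖ ≤ 2 * ℓ := by
    intro v hv
    have h1 : |v.re| ≤ ℓ := abs_le.2 hv.1
    have h2 : |v.im| ≤ ℓ := abs_le.2 hv.2
    linarith [Complex.norm_le_abs_re_add_abs_im v]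
  set G : (Fin N → ℂ) → ENNReal := fun x =>
    ENNReal.ofReal (2 * δ * ‖u x‖ ^ 2 + 2 * ℓ ^ 2 / δ * covSq α u j x) with hG
  have hum : Measurable u := hu.continuous.measurable
  have hem : Measurable (covSq α u j) := measurable_covSq α hu j
  have hGm : Measurable G := by fun_prop
  set B : Set ((Fin N → ℂ) × ℂ) := {p | p.1 j + p.2 ∉ Ω} with hB
  have hBm : MeasurableSet B := by
    have : Measurable fun p : (Fin N → ℂ) × ℂ => p.1 j + p.2 := by fun_prop
    exact this hΩ.compl
  set H : (Fin N → ℂ) × ℂ → ENNReal :=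
    B.indicator fun p => ENNReal.ofReal (‖u p.1‖ ^ 2) with hH
  have hHm : Measurable H := Measurable.indicator (by fun_prop) hBm
  have hlow : ENNReal.ofReal (ℓ ^ 2 / 2) * ∫⁻ x in {x | x j ∈ S}, ENNReal.ofReal (‖u x‖ ^ 2) ≤
      ∫⁻ x, ∫⁻ v in V, H (x, v) := by
    rw [← lintegral_const_mul _ (by fun_prop)]
    refine le_trans ?_ (setLIntegral_le_lintegral {x | x j ∈ S} _)
    refine setLIntegral_mono hHm.lintegral_prod_right' fun x hx => ?_
    have hset : MeasurableSet {v : ℂ | x j + v ∉ Ω} := hΩ.compl.preimage (measurable_const_add _)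
    have : ∀ v, H (x, v) =
        {v : ℂ | x j + v ∉ Ω}.indicator (fun _ => ENNReal.ofReal (‖u x‖ ^ 2)) v := fun v => rfl
    simp only [this]
    rw [lintegral_indicator hset, lintegral_const, Measure.restrict_restrict hset,
      Measure.restrict_apply_univ, Set.inter_comm, mul_comm]
    gcongr
    exact hS _ hx
  have hup : ∫⁻ x, ∫⁻ v in V, H (x, v) ≤ ENNReal.ofReal (4 * ℓ ^ 2) * ∫⁻ x, G x := by
    rw [lintegral_lintegral_swap (f := fun x v => H (x, v)) hHm.aemeasurable]
    calc ∫⁻ v in V, ∫⁻ x, H (x, v) ≤ ∫⁻ v in V, ∫⁻ x, G x := by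
          refine setLIntegral_mono measurable_const fun v hv => ?_
          have hpt : ∀ x, H (x, v) ≤
              ∫⁻ t in Set.Ioc (0 : ℝ) 1, G (x + t • (Pi.single j v : Fin N → ℂ)) := by
            intro x
            by_cases hx : x j + v ∈ Ω
            · have : H (x, v) = 0 := Set.indicator_of_notMem (by simpa [hB] using hx) _
              rw [this]
              exact zero_le
            · have h1 : H (x, v) = ENNReal.ofReal (‖u x‖ ^ 2) := Set.indicator_of_mem hx _
              rw [h1]
              refine norm_sq_le_lintegral_translate α hu hδ j x (hVn v hv) ?_
              by_contra hne
              apply hx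
              simpa using hsupp hne j (Set.mem_univ j)
          refine (lintegral_mono hpt).trans ?_
          have hjoint : Measurable (Function.uncurry fun (x : Fin N → ℂ) (t : ℝ) =>
              G (x + t • (Pi.single j v : Fin N → ℂ))) := by
            refine hGm.comp ?_
            fun_prop
          rw [lintegral_lintegral_swap hjoint.aemeasurable]
          have hinv : ∀ t : ℝ, ∫⁻ x, G (x + t • (Pi.single j v : Fin N → ℂ)) = ∫⁻ x, G x := fun t =>
            lintegral_add_right_eq_self G _
          simp [hinv]
      _ = ENNReal.ofReal (4 * ℓ ^ 2) * ∫⁻ x, G x := by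
          rw [lintegral_const, Measure.restrict_apply_univ, hVvol, mul_comm]
  have h8 : ENNReal.ofReal (4 * ℓ ^ 2) = ENNReal.ofReal (ℓ ^ 2 / 2) * 8 := by
    rw [← ENNReal.ofReal_ofNat 8, ← ENNReal.ofReal_mul (by positivity)]
    congr 1
    ring
  have hfin := hlow.trans hup
  rw [h8, mul_assoc] at hfin
  exact (ENNReal.mul_le_mul_iff_right (by simpa using by positivity) ENNReal.ofReal_ne_top).1 hfin

/-- The index of the square of side `ℓ` in the standard grid that contains `z`. -/
def cell (ℓ : ℝ) (z : ℂ) : ℤ × ℤ := (⌊z.re / ℓ⌋, ⌊z.im / ℓ⌋)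

theorem measurable_cell (ℓ : ℝ) : Measurable (cell ℓ) := by
  unfold cell
  exact ((Complex.measurable_re.div_const ℓ).floor).prodMk
    ((Complex.measurable_im.div_const ℓ).floor)

theorem preimage_cell {ℓ : ℝ} (hℓ : 0 < ℓ) (c : ℤ × ℤ) : cell ℓ ⁻¹' {c} =
    Set.Ico (c.1 * ℓ) ((c.1 + 1) * ℓ) ×ℂ Set.Ico (c.2 * ℓ) ((c.2 + 1) * ℓ) := by
  ext z
  simp only [Set.mem_preimage, Set.mem_singleton_iff, cell, Prod.ext_iff, Int.floor_eq_iff,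
    Complex.mem_reProdIm, Set.mem_Ico, le_div_iff₀ hℓ, div_lt_iff₀ hℓ]

theorem volume_preimage_cell {ℓ : ℝ} (hℓ : 0 < ℓ) (c : ℤ × ℤ) :
    volume (cell ℓ ⁻¹' {c}) = ENNReal.ofReal (ℓ ^ 2) := by
  rw [preimage_cell hℓ, volume_reProdIm, Real.volume_Ico, Real.volume_Ico,
    ← ENNReal.ofReal_mul (by linarith)]
  congr 1
  ring

/-- There are few grid squares in which `Ω` has density at least one half. -/
theorem exists_dense_cells {Ω : Set ℂ} (hΩ : MeasurableSet Ω) (hfin : volume Ω ≠ ⊤) {ℓ : ℝ}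
    (hℓ : 0 < ℓ) : ∃ D : Finset (ℤ × ℤ), (D.card : ℝ) * (ℓ ^ 2 / 2) ≤ (volume Ω).toReal ∧
      ∀ c ∉ D, ENNReal.ofReal (ℓ ^ 2 / 2) ≤ volume (cell ℓ ⁻¹' {c} \ Ω) := by
  have hpos : 0 < ENNReal.ofReal (ℓ ^ 2 / 2) := by
    rw [ENNReal.ofReal_pos]
    positivity
  have hm : ∀ c : ℤ × ℤ, MeasurableSet (Ω ∩ cell ℓ ⁻¹' {c}) := fun c =>
    hΩ.inter (measurable_cell ℓ (measurableSet_singleton c))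
  have hdisj : Pairwise (Function.onFun Disjoint fun c : ℤ × ℤ => Ω ∩ cell ℓ ⁻¹' {c}) := by
    intro c c' hcc
    refine Disjoint.inter_left' _ (Disjoint.inter_right' _ ?_)
    exact (Set.disjoint_singleton.2 hcc).preimage _
  have hunion : ⋃ c : ℤ × ℤ, Ω ∩ cell ℓ ⁻¹' {c} ⊆ Ω :=
    Set.iUnion_subset fun c => Set.inter_subset_left
  have hfinite := Measure.finite_const_le_meas_of_disjoint_iUnion volume hpos hm hdisj
    (measure_ne_top_of_subset hunion hfin)
  refine ⟨hfinite.toFinset, ?_, ?_⟩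
  · have h1 : ∑ _c ∈ hfinite.toFinset, ENNReal.ofReal (ℓ ^ 2 / 2) ≤ volume Ω := by
      calc _ ≤ ∑ c ∈ hfinite.toFinset, volume (Ω ∩ cell ℓ ⁻¹' {c}) :=
            Finset.sum_le_sum fun c hc => by simpa using hc
        _ = volume (⋃ c ∈ hfinite.toFinset, Ω ∩ cell ℓ ⁻¹' {c}) :=
            (measure_biUnion_finset (fun c _ c' _ hcc => hdisj hcc) fun c _ => hm c).symm
        _ ≤ volume Ω := measure_mono (Set.iUnion₂_subset fun c _ => Set.inter_subset_left)
    rw [Finset.sum_const, nsmul_eq_mul, ← ENNReal.ofReal_natCast,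
      ← ENNReal.ofReal_mul (by positivity)] at h1
    exact (ENNReal.ofReal_le_iff_le_toReal hfin).1 h1
  · intro c hc
    have hc' : volume (Ω ∩ cell ℓ ⁻¹' {c}) < ENNReal.ofReal (ℓ ^ 2 / 2) := by simpa using hc
    by_contra! hlt
    have h1 := measure_inter_add_sdiff (μ := volume) (cell ℓ ⁻¹' {c}) hΩ
    rw [volume_preimage_cell hℓ, Set.inter_comm] at h1
    have h2 := ENNReal.add_lt_add hc' hlt
    rw [h1, ← ENNReal.ofReal_add (by positivity) (by positivity), add_halves] at h2
    exact lt_irrefl _ h2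

/-- Points of sparse grid squares have many translates outside `Ω`. -/
theorem le_volume_translates {Ω : Set ℂ} {ℓ : ℝ} (hℓ : 0 < ℓ) (z : ℂ)
    (hz : ENNReal.ofReal (ℓ ^ 2 / 2) ≤ volume (cell ℓ ⁻¹' {cell ℓ z} \ Ω)) :
    ENNReal.ofReal (ℓ ^ 2 / 2) ≤
      volume ((Set.Icc (-ℓ) ℓ ×ℂ Set.Icc (-ℓ) ℓ) ∩ {v | z + v ∉ Ω}) := by
  refine hz.trans ?_
  rw [← measure_preimage_add volume z (cell ℓ ⁻¹' {cell ℓ z} \ Ω)]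
  refine measure_mono fun v hv => ⟨?_, hv.2⟩
  have h1 : z + v ∈ cell ℓ ⁻¹' {cell ℓ z} := hv.1
  have h2 : z ∈ cell ℓ ⁻¹' {cell ℓ z} := rfl
  rw [preimage_cell hℓ] at h1 h2
  simp only [Complex.mem_reProdIm, Set.mem_Ico, Complex.add_re, Complex.add_im] at h1 h2
  simp only [Complex.mem_reProdIm, Set.mem_Icc]
  refine ⟨⟨?_, ?_⟩, ?_, ?_⟩ <;> linarith [h1.1.1, h1.1.2, h1.2.1, h1.2.2, h2.1.1, h2.1.2,
    h2.2.1, h2.2.2]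

/-- The particles whose grid square is at distance at most four squares from `c`. -/
def nearCell {N : ℕ} (ℓ : ℝ) (x : Fin N → ℂ) (c : ℤ × ℤ) : Finset (Fin N) :=
  {i | cell ℓ (x i) ∈ Finset.Icc (c.1 - 4) (c.1 + 4) ×ˢ Finset.Icc (c.2 - 4) (c.2 + 4)}

theorem sum_card_nearCell_le {N : ℕ} (ℓ : ℝ) (x : Fin N → ℂ) (D : Finset (ℤ × ℤ)) :
    ∑ c ∈ D, ((nearCell ℓ x c).card : ℝ) ≤ 81 * N := by
  have h1 : ∑ c ∈ D, (nearCell ℓ x c).card ≤ 81 * N := by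
    simp only [nearCell, Finset.card_filter]
    rw [Finset.sum_comm]
    calc _ ≤ ∑ _i : Fin N, 81 := Finset.sum_le_sum fun i _ => ?_
      _ = 81 * N := by simp [mul_comm]
    rw [← Finset.card_filter]
    set b := cell ℓ (x i)
    have hsub : (D.filter fun c => b ∈ Finset.Icc (c.1 - 4) (c.1 + 4) ×ˢ
        Finset.Icc (c.2 - 4) (c.2 + 4)) ⊆
        Finset.Icc (b.1 - 4) (b.1 + 4) ×ˢ Finset.Icc (b.2 - 4) (b.2 + 4) := by
      intro c hc
      simp only [Finset.mem_filter, Finset.mem_product, Finset.mem_Icc] at hc ⊢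
      omega
    refine (Finset.card_le_card hsub).trans ?_
    rw [Finset.card_product, Int.card_Icc, Int.card_Icc]
    have h9 : ∀ a : ℤ, (a + 4 + 1 - (a - 4)).toNat = 9 := fun a => by omega
    rw [h9, h9]
  exact_mod_cast h1

theorem inv_card_nearCell_le_pairWeight {N : ℕ} {ℓ : ℝ} (hℓ : 0 < ℓ) (x : Fin N → ℂ)
    {j k : Fin N} (hjk : j ≠ k) {c : ℤ × ℤ} (hj : cell ℓ (x j) = c) (hk : cell ℓ (x k) = c) :
    ((nearCell ℓ x c).card : ℝ)⁻¹ ≤ pairWeight ℓ j k x := by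
  have hj' : x j ∈ cell ℓ ⁻¹' {c} := hj
  have hk' : x k ∈ cell ℓ ⁻¹' {c} := hk
  rw [preimage_cell hℓ] at hj' hk'
  simp only [Complex.mem_reProdIm, Set.mem_Ico] at hj' hk'
  obtain ⟨⟨hj1, hj2⟩, hj3, hj4⟩ := hj'
  obtain ⟨⟨hk1, hk2⟩, hk3, hk4⟩ := hk'
  have hclose : ‖x j - x k‖ ≤ 2 * ℓ := by
    have h1 : |(x j - x k).re| ≤ ℓ := by
      rw [Complex.sub_re, abs_le]
      constructor <;> linarith
    have h2 : |(x j - x k).im| ≤ ℓ := by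
      rw [Complex.sub_im, abs_le]
      constructor <;> linarith
    linarith [Complex.norm_le_abs_re_add_abs_im (x j - x k)]
  have hself : ∀ i, cell ℓ (x i) = c → i ∈ nearCell ℓ x c := by
    intro i hi
    simp [nearCell, hi]
  have hjm := hself j hj
  have hkm : k ∈ (nearCell ℓ x c).erase j := Finset.mem_erase.2 ⟨hjk.symm, hself k hk⟩
  rw [pairWeight, if_pos hclose, ← Finset.sum_filter, Finset.sum_const, nsmul_eq_mul, mul_one]
  have hsub : ((Finset.univ.erase j).erase k).filter
      (fun i => ‖x i - (x j + x k) / 2‖ ≤ 3 * ℓ) ⊆ ((nearCell ℓ x c).erase j).erase k := by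
    intro i hi
    simp only [Finset.mem_filter, Finset.mem_erase, Finset.mem_univ, and_true] at hi
    obtain ⟨⟨hik, hij⟩, hd⟩ := hi
    refine Finset.mem_erase.2 ⟨hik, Finset.mem_erase.2 ⟨hij, ?_⟩⟩
    have h1 := abs_le.1 ((Complex.abs_re_le_norm _).trans hd)
    have h2 := abs_le.1 ((Complex.abs_im_le_norm _).trans hd)
    have hre : (x i - (x j + x k) / 2).re = (x i).re - ((x j).re + (x k).re) / 2 := by simp
    have him : (x i - (x j + x k) / 2).im = (x i).im - ((x j).im + (x k).im) / 2 := by simp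
    rw [hre] at h1
    rw [him] at h2
    have e1 : c.1 - 4 ≤ ⌊(x i).re / ℓ⌋ := by
      rw [Int.le_floor, le_div_iff₀ hℓ]
      push_cast
      linarith
    have e2 : ⌊(x i).re / ℓ⌋ < c.1 + 5 := by
      rw [Int.floor_lt, div_lt_iff₀ hℓ]
      push_cast
      linarith
    have e3 : c.2 - 4 ≤ ⌊(x i).im / ℓ⌋ := by
      rw [Int.le_floor, le_div_iff₀ hℓ]
      push_cast
      linarith
    have e4 : ⌊(x i).im / ℓ⌋ < c.2 + 5 := by
      rw [Int.floor_lt, div_lt_iff₀ hℓ]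
      push_cast
      linarith
    simp only [nearCell, cell, Finset.mem_filter, Finset.mem_univ, true_and, Finset.mem_product,
      Finset.mem_Icc]
    omega
  have hcard := Finset.card_le_card hsub
  have hc1 := Finset.card_erase_add_one hkm
  have hc2 := Finset.card_erase_add_one hjm
  refine inv_anti₀ (by positivity) ?_
  rw [← hc2, ← hc1]
  push_cast
  have : ((((Finset.univ.erase j).erase k).filter
      (fun i => ‖x i - (x j + x k) / 2‖ ≤ 3 * ℓ)).card : ℝ) ≤
        (((nearCell ℓ x c).erase j).erase k).card := by exact_mod_cast hcard
  linarith

/-- Configurations with many particles in the squares of `D` have a large total pair weight. -/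
theorem le_sum_pairWeight {N : ℕ} {ℓ : ℝ} (hℓ : 0 < ℓ) (x : Fin N → ℂ) (D : Finset (ℤ × ℤ)) :
    (∑ j, if cell ℓ (x j) ∈ D then (1 : ℝ) else 0) / 81 - N / 324 - D.card ≤
      ∑ j, ∑ k ∈ Finset.univ.erase j, pairWeight ℓ j k x := by
  set occ : ℤ × ℤ → Finset (Fin N) := fun c => {j | cell ℓ (x j) = c} with hocc
  have hfiber : ∀ g : Fin N → ℝ, ∑ c ∈ D, ∑ j ∈ occ c, g j =
      ∑ j, if cell ℓ (x j) ∈ D then g j else 0 := by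
    intro g
    simp only [hocc, Finset.sum_filter]
    rw [Finset.sum_comm]
    simp
  have hone : ∑ c ∈ D, ((occ c).card : ℝ) = ∑ j, if cell ℓ (x j) ∈ D then (1 : ℝ) else 0 := by
    rw [← hfiber]
    simp
  have hnn : ∀ j, 0 ≤ ∑ k ∈ Finset.univ.erase j, pairWeight ℓ j k x := fun j =>
    Finset.sum_nonneg fun k _ => pairWeight_nonneg x
  have hcell : ∀ c, ((occ c).card : ℝ) / 81 - (nearCell ℓ x c).card / 162 ^ 2 - 1 ≤
      ∑ j ∈ occ c, ∑ k ∈ Finset.univ.erase j, pairWeight ℓ j k x := by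
    intro c
    set n : ℝ := ((occ c).card : ℝ) with hn
    set m : ℝ := ((nearCell ℓ x c).card : ℝ) with hm
    have hlow : n * ((n - 1) * m⁻¹) ≤
        ∑ j ∈ occ c, ∑ k ∈ Finset.univ.erase j, pairWeight ℓ j k x := by
      rw [hn, ← nsmul_eq_mul]
      refine Finset.card_nsmul_le_sum _ _ _ fun j hj => ?_
      have hj' : cell ℓ (x j) = c := by simpa [hocc] using hj
      refine le_trans ?_ (Finset.sum_le_sum_of_subset_of_nonneg
        (Finset.erase_subset_erase j (Finset.subset_univ (occ c)))
        fun k _ _ => pairWeight_nonneg x)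
      rw [← hn]
      have hcard : n - 1 = ((occ c).erase j).card := by
        rw [hn, ← Finset.card_erase_add_one hj]
        push_cast
        ring
      rw [hcard, ← nsmul_eq_mul]
      refine Finset.card_nsmul_le_sum _ _ _ fun k hk => ?_
      have hk' : k ≠ j ∧ cell ℓ (x k) = c := by simpa [hocc] using hk
      exact inv_card_nearCell_le_pairWeight hℓ x hk'.1.symm hj' hk'.2
    refine le_trans ?_ hlow
    have hnm : n ≤ m := by
      rw [hn, hm]
      exact_mod_cast Finset.card_le_card fun i hi => by
        have hi' : cell ℓ (x i) = c := by simpa [hocc] using hi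
        simp [nearCell, hi']
    have hn0 : 0 ≤ n := Nat.cast_nonneg _
    rcases (hn0.trans hnm).eq_or_lt with h0 | hpos
    · have : n = 0 := by linarith
      rw [← h0, this]
      norm_num
    · have h1 : n * ((n - 1) * m⁻¹) - (n / 81 - m / 162 ^ 2 - 1) =
          ((n - m / 162) ^ 2 + (m - n)) / m := by
        field_simp
        ring
      have h2 : 0 ≤ ((n - m / 162) ^ 2 + (m - n)) / m :=
        div_nonneg (add_nonneg (sq_nonneg _) (sub_nonneg.2 hnm)) hpos.le
      linarith
  have hsum := Finset.sum_le_sum fun c (_ : c ∈ D) => hcell c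
  rw [Finset.sum_sub_distrib, Finset.sum_sub_distrib, ← Finset.sum_div, ← Finset.sum_div, hone,
    hfiber, Finset.sum_const, nsmul_eq_mul, mul_one] at hsum
  have hdrop : (∑ j, if cell ℓ (x j) ∈ D then
      ∑ k ∈ Finset.univ.erase j, pairWeight ℓ j k x else 0) ≤
        ∑ j, ∑ k ∈ Finset.univ.erase j, pairWeight ℓ j k x :=
    Finset.sum_le_sum fun j _ => by
      split_ifs
      exacts [le_rfl, hnn j]
  linarith [sum_card_nearCell_le ℓ x D]

/-- Mass bound for a particle in the sparse grid squares. -/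
theorem lintegral_sparse_le (α : ℝ) {N : ℕ} {u : (Fin N → ℂ) → ℂ}
    (hu : ContDiff ℝ (⊤ : ℕ∞) u) {ℓ : ℝ} (hℓ : 0 < ℓ) (j : Fin N) {Ω : Set ℂ}
    (hΩ : MeasurableSet Ω) (hsupp : Function.support u ⊆ Set.univ.pi (fun _ : Fin N => Ω))
    (D : Finset (ℤ × ℤ))
    (hD : ∀ c ∉ D, ENNReal.ofReal (ℓ ^ 2 / 2) ≤ volume (cell ℓ ⁻¹' {c} \ Ω)) :
    ∫⁻ x in {x | cell ℓ (x j) ∉ D}, ENNReal.ofReal (‖u x‖ ^ 2) ≤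
      ENNReal.ofReal (1 / 4) * (∫⁻ x, ENNReal.ofReal (‖u x‖ ^ 2)) +
        ENNReal.ofReal (1024 * ℓ ^ 2) * ∫⁻ x, ENNReal.ofReal (covSq α u j x) := by
  have hum : Measurable u := hu.continuous.measurable
  have hem : Measurable (covSq α u j) := measurable_covSq α hu j
  refine (sparse_mass_le α hu hℓ (by norm_num : (0 : ℝ) < 1 / 64) j (S := {z | cell ℓ z ∉ D}) hΩ
    hsupp fun z hz => le_volume_translates hℓ z (hD _ hz)).trans_eq ?_
  have h2 : 2 * ℓ ^ 2 / (1 / 64) = 128 * ℓ ^ 2 := by ring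
  have hsplit : ∀ x, ENNReal.ofReal (2 * (1 / 64) * ‖u x‖ ^ 2 + 2 * ℓ ^ 2 / (1 / 64) *
      covSq α u j x) = ENNReal.ofReal (1 / 32) * ENNReal.ofReal (‖u x‖ ^ 2) +
        ENNReal.ofReal (128 * ℓ ^ 2) * ENNReal.ofReal (covSq α u j x) := fun x => by
    have h1 : (2 * (1 / 64) : ℝ) = 1 / 32 := by norm_num
    rw [h1, h2, ENNReal.ofReal_add (by positivity)
        (mul_nonneg (by positivity) (covSq_nonneg _ _ _ _)),
      ENNReal.ofReal_mul (by positivity : (0 : ℝ) ≤ 1 / 32),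
      ENNReal.ofReal_mul (by positivity : 0 ≤ 128 * ℓ ^ 2)]
  simp only [hsplit]
  have h3 : (8 : ENNReal) * ENNReal.ofReal (1 / 32) = ENNReal.ofReal (1 / 4) := by
    rw [← ENNReal.ofReal_ofNat 8, ← ENNReal.ofReal_mul (by norm_num)]
    norm_num
  have h4 : (8 : ENNReal) * ENNReal.ofReal (128 * ℓ ^ 2) = ENNReal.ofReal (1024 * ℓ ^ 2) := by
    rw [← ENNReal.ofReal_ofNat 8, ← ENNReal.ofReal_mul (by norm_num)]
    congr 1
    ring
  rw [lintegral_add_left (by fun_prop), lintegral_const_mul _ (by fun_prop),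
    lintegral_const_mul _ (by fun_prop), mul_add, ← mul_assoc, ← mul_assoc, h3, h4]

/-- The total mass is controlled by the weighted number of close pairs and by the mass in
sparse grid squares. -/
theorem mass_le_exclusion_add_sparse (α : ℝ) {N : ℕ} {u : (Fin N → ℂ) → ℂ}
    (hu : IsAnyonWF N u) {ℓ : ℝ} (hℓ : 0 < ℓ) (D : Finset (ℤ × ℤ))
    (hcard : (D.card : ℝ) ≤ N / 324) :
    ENNReal.ofReal (statC α N ^ 2 * (N / 162)) * ∫⁻ x, ENNReal.ofReal (‖u x‖ ^ 2) ≤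
      ENNReal.ofReal (Real.pi ^ 2 * ℓ ^ 2) *
        (∑ j : Fin N, ∫⁻ x, ENNReal.ofReal (covSq α u j x)) +
      ENNReal.ofReal (statC α N ^ 2 / 81) *
        ∑ j : Fin N, ∫⁻ x in {x | cell ℓ (x j) ∉ D}, ENNReal.ofReal (‖u x‖ ^ 2) := by
  have hum : Measurable u := hu.smooth.continuous.measurable
  have hwm : ∀ j k : Fin N, Measurable (pairWeight ℓ j k) := fun j k => measurable_pairWeight
  have hset : ∀ j : Fin N, MeasurableSet {x : Fin N → ℂ | cell ℓ (x j) ∉ D} := fun j =>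
    ((measurable_cell ℓ).comp (measurable_pi_apply j)) D.measurableSet.compl
  refine le_trans ?_ (add_le_add_left (exclusion α hu ℓ) _)
  simp only [← lintegral_indicator (hset _)]
  rw [← lintegral_finsetSum _ fun j _ => Measurable.indicator (by fun_prop) (hset j),
    ← lintegral_const_mul _ (by fun_prop), ← lintegral_const_mul _ (Finset.measurable_fun_sum _
      fun j _ => Measurable.indicator (by fun_prop) (hset j)),
    ← lintegral_add_left (by fun_prop)]
  refine lintegral_mono fun x => ?_
  have hind : ∀ j : Fin N, {x : Fin N → ℂ | cell ℓ (x j) ∉ D}.indicator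
      (fun x => ENNReal.ofReal (‖u x‖ ^ 2)) x =
        ENNReal.ofReal ((1 - if cell ℓ (x j) ∈ D then (1 : ℝ) else 0) * ‖u x‖ ^ 2) := by
    intro j
    by_cases h : cell ℓ (x j) ∈ D <;> simp [h]
  have hnn : ∀ j : Fin N, 0 ≤ 1 - if cell ℓ (x j) ∈ D then (1 : ℝ) else 0 := by
    intro j
    split_ifs <;> norm_num
  simp only [hind]
  rw [← ENNReal.ofReal_sum_of_nonneg fun j _ => mul_nonneg (hnn j) (sq_nonneg _),
    ← ENNReal.ofReal_mul (by positivity), ← ENNReal.ofReal_mul (by positivity),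
    ← ENNReal.ofReal_add]
  · refine ENNReal.ofReal_le_ofReal ?_
    rw [← Finset.sum_mul, Finset.sum_sub_distrib]
    have h1 := le_sum_pairWeight hℓ x D
    set P := ∑ j, ∑ k ∈ Finset.univ.erase j, pairWeight ℓ j k x
    set n := ∑ j, if cell ℓ (x j) ∈ D then (1 : ℝ) else 0
    have h2 : (N : ℝ) / 162 ≤ P + (N - n) / 81 := by linarith
    have h3 : 0 ≤ statC α N ^ 2 * ‖u x‖ ^ 2 := by positivity
    have h4 := mul_le_mul_of_nonneg_left h2 h3
    simp only [Finset.sum_const, Finset.card_univ, Fintype.card_fin, nsmul_eq_mul, mul_one]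
    linarith
  · exact mul_nonneg (sq_nonneg _) (mul_nonneg (Finset.sum_nonneg fun j _ =>
      Finset.sum_nonneg fun k _ => pairWeight_nonneg x) (sq_nonneg _))
  · exact mul_nonneg (by positivity)
      (Finset.sum_nonneg fun j _ => mul_nonneg (hnn j) (sq_nonneg _))

/-- **Corollary (ground state energy bound for the anyon gas).** There is a universal
`C_K > 0` such that for every `α`, every `N ≥ 2`, every measurable `Ω ⊆ ℝ²` of finite
positive area, and every normalized `N`-anyon wave function `u` supported in `Ω^N`:
`∑_j ∫ |D_j u|² ≥ C_K · C_{α,N}² · N²/|Ω|`. -/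
theorem ground_state_energy_bound :
    ∃ C : ℝ, 0 < C ∧ ∀ (α : ℝ) (N : ℕ), 2 ≤ N →
      ∀ Ω : Set ℂ, MeasurableSet Ω → 0 < volume Ω → volume Ω ≠ ⊤ →
      ∀ u : (Fin N → ℂ) → ℂ, IsAnyonWF N u → (∫ x : Fin N → ℂ, ‖u x‖ ^ 2) = 1 →
      Function.support u ⊆ Set.univ.pi (fun _ : Fin N => Ω) →
      ENNReal.ofReal (C * statC α N ^ 2 * (N : ℝ) ^ 2 / (volume Ω).toReal) ≤
        ∑ j : Fin N, ∫⁻ x : Fin N → ℂ, ENNReal.ofReal (covSq α u j x) := by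
  refine ⟨1 / (324 * 23 * 648), by norm_num, ?_⟩
  intro α N hN Ω hΩ hΩ0 hΩfin u hu hnorm hsupp
  set T := ∑ j : Fin N, ∫⁻ x : Fin N → ℂ, ENNReal.ofReal (covSq α u j x) with hT
  rcases eq_or_ne T ⊤ with htop | htop
  · rw [htop]
    exact le_top
  set A : ℝ := (volume Ω).toReal with hA
  have hA0 : 0 < A := ENNReal.toReal_pos hΩ0.ne' hΩfin
  have hN0 : (0 : ℝ) < N := by
    have : 0 < N := by omega
    exact_mod_cast this
  set ℓ : ℝ := √(648 * A / N) with hℓdef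
  have hℓ : 0 < ℓ := Real.sqrt_pos.2 (by positivity)
  have hℓsq : ℓ ^ 2 = 648 * A / N := Real.sq_sqrt (by positivity)
  obtain ⟨D, hcard, hD⟩ := exists_dense_cells hΩ hΩfin hℓ
  have hcard' : (D.card : ℝ) ≤ N / 324 := by
    rw [hℓsq, ← hA] at hcard
    have h1 : (D.card : ℝ) * (648 * A / N / 2) = D.card * (324 * A / N) := by ring
    rw [h1, ← le_div_iff₀ (by positivity)] at hcard
    refine hcard.trans_eq ?_
    field_simp
  have hmass : ∫⁻ x, ENNReal.ofReal (‖u x‖ ^ 2) = 1 := by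
    rw [← ofReal_integral_eq_lintegral_ofReal, hnorm, ENNReal.ofReal_one]
    · by_contra hint
      rw [integral_undef hint] at hnorm
      exact zero_ne_one hnorm
    · exact Filter.Eventually.of_forall fun x => sq_nonneg _
  have hmain := mass_le_exclusion_add_sparse α hu hℓ D hcard'
  have hsparse := Finset.sum_le_sum fun j (_ : j ∈ Finset.univ) =>
    lintegral_sparse_le α hu.smooth hℓ j hΩ hsupp D hD
  rw [Finset.sum_add_distrib, ← Finset.mul_sum, ← Finset.mul_sum, ← hT, hmass,
    Finset.sum_const, Finset.card_univ, Fintype.card_fin, nsmul_eq_mul, mul_one] at hsparse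
  rw [← hT, hmass, mul_one] at hmain
  replace hmain := hmain.trans (add_le_add_right (mul_le_mul_right hsparse _) _)
  set t := T.toReal with ht
  have hTt : T = ENNReal.ofReal t := (ENNReal.ofReal_toReal htop).symm
  have ht0 : 0 ≤ t := ENNReal.toReal_nonneg
  rw [hTt, ← ENNReal.ofReal_natCast, ← ENNReal.ofReal_mul (by positivity),
    ← ENNReal.ofReal_mul (by positivity), ← ENNReal.ofReal_mul (by positivity),
    ← ENNReal.ofReal_add (by positivity) (by positivity), ← ENNReal.ofReal_mul (by positivity),
    ← ENNReal.ofReal_add (by positivity) (by positivity),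
    ENNReal.ofReal_le_ofReal_iff (by positivity)] at hmain
  rw [hTt]
  refine ENNReal.ofReal_le_ofReal ?_
  have hs1 : statC α N ^ 2 ≤ 1 := pow_le_one₀ (statC_nonneg α N) (statC_le_one α N hN)
  have hs0 : 0 ≤ statC α N ^ 2 := sq_nonneg _
  set s := statC α N ^ 2
  set L := ℓ ^ 2 * t with hL
  have hL0 : 0 ≤ L := by positivity
  have hpi : Real.pi ^ 2 * L ≤ 10 * L := by
    refine mul_le_mul_of_nonneg_right ?_ hL0
    nlinarith [Real.pi_lt_d2, Real.pi_pos]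
  have hsL : s * L ≤ L := mul_le_of_le_one_left hL0 hs1
  have hfinal : s * N / 324 ≤ 23 * L := by nlinarith
  rw [hL, hℓsq] at hfinal
  rw [div_le_iff₀ hA0]
  have h1 : 23 * (648 * A / N * t) = 23 * 648 * (A * t) / N := by ring
  rw [h1, le_div_iff₀ hN0] at hfinal
  linarith

end
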